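/- Let f : X → [0, b] be measurable and let x₁,…,xₙ be a time-homogeneous Markov chain on X that uniformly quickly forgets its past (τ = sup_n ‖Γₙ‖² < ∞), with f̂ = (1/n)·Σ_{i=1}^n f(x_i). Then there exist constants c₁ > 0 and c₂ ≥ 1 depending only on the transition kernel such that for any 0 < ξ < 1, with probability at least 1 − ξ: |E[f̂] − f̂| ≤ b·√((c₁/n)·log(c₂/ξ)). -/

import Mathlib

open MeasureTheory ProbabilityTheory Matrix

noncomputable section

/-- Euclidean (`L²`) norm of a finite-dimensional real vector. -/
def e2norm {m : Type*} [Fintype m] (v : m → ℝ) : ℝ := Real.sqrt (∑ i, v i ^ 2)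

/-- Operator norm of a real matrix (w.r.t. Euclidean norms). -/
def opNorm {m n : Type*} [Fintype m] [Fintype n] (M : Matrix m n ℝ) : ℝ :=
  sSup {r | ∃ v : n → ℝ, e2norm v ≤ 1 ∧ r = e2norm (M.mulVec v)}

/-- Total variation distance between two measures: `sup_A |μ(A) - ν(A)|`. -/
def tvDist {S : Type*} [MeasurableSpace S] (μ ν : Measure S) : ℝ :=
  sSup {r | ∃ A : Set S, MeasurableSet A ∧ r = |(μ A).toReal - (ν A).toReal|}

/-- The `i`-step transition kernel `T^i`. -/
def kernelIter {S : Type*} [MeasurableSpace S] (T : ProbabilityTheory.Kernel S S) :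
    ℕ → ProbabilityTheory.Kernel S S
  | 0 => ProbabilityTheory.Kernel.id
  | (i + 1) => T ∘ₖ kernelIter T i

/-- The dependence matrix `Γₙ` of a Markov transition kernel. -/
def depMatrix {S : Type*} [MeasurableSpace S] (T : ProbabilityTheory.Kernel S S) (n : ℕ) :
    Matrix (Fin n) (Fin n) ℝ :=
  Matrix.of fun i j =>
    if i = j then 1
    else if i < j then
      Real.sqrt (sSup {r | ∃ p : S × S,
        r = tvDist (kernelIter T ((j : ℕ) - (i : ℕ)) p.1) (kernelIter T ((j : ℕ) - (i : ℕ)) p.2)})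
    else 0

/-- A time-homogeneous Markov chain uniformly quickly forgets its past if
`τ = sup_n ‖Γₙ‖² < ∞`. -/
def UniformlyQuicklyForgets {S : Type*} [MeasurableSpace S]
    (T : ProbabilityTheory.Kernel S S) : Prop :=
  ∃ τ : ℝ, ∀ n : ℕ, opNorm (depMatrix T n) ^ 2 ≤ τ

/-- σ-algebra generated by `x 0, …, x t`. -/
def pastFiltration {Ω S : Type*} [MeasurableSpace S] (x : ℕ → Ω → S) (t : ℕ) :
    MeasurableSpace Ω :=
  MeasurableSpace.comap (fun ω => fun i : Fin (t + 1) => x i ω) inferInstance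

/-- `x 0, …, x (n-1)` is a time-homogeneous Markov chain with transition kernel `T`
under `P`. -/
def IsMarkovChain {Ω : Type*} {S : Type*} [MeasurableSpace Ω] [MeasurableSpace S]
    (P : Measure Ω) (T : ProbabilityTheory.Kernel S S) (x : ℕ → Ω → S) (n : ℕ) : Prop :=
  (∀ t, t < n → Measurable (x t)) ∧
  ∀ t, t + 1 < n → ∀ A : Set S, MeasurableSet A →
    (P[fun ω => A.indicator (fun _ => (1 : ℝ)) (x (t + 1) ω) | pastFiltration x t])
      =ᵐ[P] fun ω => (T (x t ω) A).toReal

section Helpers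

open Real

variable {S : Type*} [MeasurableSpace S]

/-! ### The dependence matrix controls the sum of the mixing coefficients -/

lemma e2norm_mulVec_le {m n : Type*} [Fintype m] [Fintype n] (M : Matrix m n ℝ) (v : n → ℝ)
    (hv : e2norm v ≤ 1) : e2norm (M.mulVec v) ≤ √(∑ i, ∑ j, M i j ^ 2) := by
  have hv' : ∑ j, v j ^ 2 ≤ 1 := by
    rwa [e2norm, Real.sqrt_le_one] at hv
  refine Real.sqrt_le_sqrt (Finset.sum_le_sum fun i _ => ?_)
  calc (M.mulVec v i) ^ 2 ≤ (∑ j, M i j ^ 2) * ∑ j, v j ^ 2 :=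
        Finset.sum_mul_sq_le_sq_mul_sq _ _ _
    _ ≤ (∑ j, M i j ^ 2) * 1 :=
        mul_le_mul_of_nonneg_left hv' (Finset.sum_nonneg fun _ _ => sq_nonneg _)
    _ = _ := mul_one _

lemma e2norm_mulVec_le_opNorm {m n : Type*} [Fintype m] [Fintype n] (M : Matrix m n ℝ)
    (v : n → ℝ) (hv : e2norm v ≤ 1) : e2norm (M.mulVec v) ≤ opNorm M := by
  refine le_csSup ⟨√(∑ i, ∑ j, M i j ^ 2), ?_⟩ ⟨v, hv, rfl⟩
  rintro r ⟨w, hw, rfl⟩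
  exact e2norm_mulVec_le M w hw

lemma sum_col_sq_le_opNorm_sq {m n : Type*} [Fintype m] [Fintype n] (M : Matrix m n ℝ)
    (j : n) : ∑ i, M i j ^ 2 ≤ opNorm M ^ 2 := by
  classical
  have hv : e2norm (Pi.single j (1 : ℝ)) ≤ 1 := by
    simp [e2norm, Pi.single_apply]
  have h := e2norm_mulVec_le_opNorm M _ hv
  have h0 : (0 : ℝ) ≤ ∑ i, M i j ^ 2 := Finset.sum_nonneg fun _ _ => sq_nonneg _
  have he : e2norm (M.mulVec (Pi.single j (1 : ℝ))) = √(∑ i, M i j ^ 2) := by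
    simp [e2norm]
  rw [he] at h
  calc ∑ i, M i j ^ 2 = √(∑ i, M i j ^ 2) ^ 2 := (Real.sq_sqrt h0).symm
    _ ≤ _ := pow_le_pow_left₀ (Real.sqrt_nonneg _) h 2

/-- The worst-case total variation distance between the `k`-step transition laws. -/
def mixCoeff (T : Kernel S S) (k : ℕ) : ℝ :=
  sSup {r | ∃ p : S × S, r = tvDist (kernelIter T k p.1) (kernelIter T k p.2)}

lemma tvDist_nonneg (μ ν : Measure S) : 0 ≤ tvDist μ ν := by
  refine Real.sSup_nonneg ?_
  rintro r ⟨A, _, rfl⟩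
  exact abs_nonneg _

lemma abs_measureReal_sub_le_one (μ ν : Measure S) [IsProbabilityMeasure μ]
    [IsProbabilityMeasure ν] (A : Set S) : |(μ A).toReal - (ν A).toReal| ≤ 1 :=
  abs_sub_le_of_nonneg_of_le ENNReal.toReal_nonneg measureReal_le_one
    ENNReal.toReal_nonneg measureReal_le_one

lemma tvDist_le_one (μ ν : Measure S) [IsProbabilityMeasure μ] [IsProbabilityMeasure ν] :
    tvDist μ ν ≤ 1 := by
  refine Real.sSup_le ?_ zero_le_one
  rintro r ⟨A, _, rfl⟩
  exact abs_measureReal_sub_le_one μ ν A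

lemma le_tvDist (μ ν : Measure S) [IsProbabilityMeasure μ] [IsProbabilityMeasure ν]
    {A : Set S} (hA : MeasurableSet A) : |μ.real A - ν.real A| ≤ tvDist μ ν := by
  refine le_csSup ⟨1, ?_⟩ ⟨A, hA, rfl⟩
  rintro r ⟨B, _, rfl⟩
  exact abs_measureReal_sub_le_one μ ν B

instance isMarkovKernel_kernelIter (T : Kernel S S) [IsMarkovKernel T] (k : ℕ) :
    IsMarkovKernel (kernelIter T k) := by
  induction k with
  | zero => unfold kernelIter; infer_instance
  | succ k ih => unfold kernelIter; infer_instance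

lemma mixCoeff_nonneg (T : Kernel S S) (k : ℕ) : 0 ≤ mixCoeff T k := by
  refine Real.sSup_nonneg ?_
  rintro r ⟨p, rfl⟩
  exact tvDist_nonneg _ _

lemma tvDist_le_mixCoeff (T : Kernel S S) [IsMarkovKernel T] (k : ℕ) (s s' : S) :
    tvDist (kernelIter T k s) (kernelIter T k s') ≤ mixCoeff T k := by
  refine le_csSup ⟨1, ?_⟩ ⟨(s, s'), rfl⟩
  rintro r ⟨p, rfl⟩
  exact tvDist_le_one _ _

lemma mixCoeff_le_one (T : Kernel S S) [IsMarkovKernel T] (k : ℕ) : mixCoeff T k ≤ 1 := by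
  refine Real.sSup_le ?_ zero_le_one
  rintro r ⟨p, rfl⟩
  exact tvDist_le_one _ _

lemma sum_mixCoeff_le (T : Kernel S S) [IsMarkovKernel T] (n : ℕ) :
    ∑ k ∈ Finset.range (n + 1), mixCoeff T k ≤ opNorm (depMatrix T (n + 1)) ^ 2 := by
  refine le_trans ?_ (sum_col_sq_le_opNorm_sq (depMatrix T (n + 1)) (Fin.last n))
  rw [← Finset.sum_range_reflect, Finset.sum_range]
  refine Finset.sum_le_sum fun i _ => ?_
  by_cases hi : i = Fin.last n
  · subst hi
    simpa [depMatrix] using mixCoeff_le_one T 0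
  · have hlt : i < Fin.last n := Fin.lt_last_iff_ne_last.mpr hi
    have := mixCoeff_nonneg T (n - i)
    simp only [depMatrix, Matrix.of_apply, hi, hlt, if_true, if_false, Fin.val_last]
    change _ ≤ √(mixCoeff T (n - i)) ^ 2
    rw [Real.sq_sqrt this, Nat.add_sub_cancel]

/-! ### Oscillation of the iterated transition operators -/

lemma integrable_of_mem_Icc {μ : Measure S} [IsFiniteMeasure μ] {f : S → ℝ} {a b : ℝ}
    (hf : Measurable f) (hfb : ∀ s, f s ∈ Set.Icc a b) : Integrable f μ :=
  Integrable.of_mem_Icc a b hf.aemeasurable (Filter.Eventually.of_forall hfb)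

lemma integral_sub_integral_le_mul_tvDist (μ ν : Measure S) [IsProbabilityMeasure μ]
    [IsProbabilityMeasure ν] {f : S → ℝ} {b : ℝ} (hb : 0 ≤ b) (hf : Measurable f)
    (hfb : ∀ s, f s ∈ Set.Icc 0 b) :
    ∫ s, f s ∂μ - ∫ s, f s ∂ν ≤ b * tvDist μ ν := by
  have key : ∀ ρ : Measure S, IsProbabilityMeasure ρ →
      ∫ s, f s ∂ρ = ∫ t in Set.Ioc 0 b, ρ.real {a | t ≤ f a} := fun ρ _ =>
    (integrable_of_mem_Icc hf hfb).integral_eq_integral_Ioc_meas_le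
      (Filter.Eventually.of_forall fun s => (hfb s).1)
      (Filter.Eventually.of_forall fun s => (hfb s).2)
  have hint : ∀ ρ : Measure S, IsProbabilityMeasure ρ →
      IntegrableOn (fun t => ρ.real {a | t ≤ f a}) (Set.Ioc 0 b) := by
    intro ρ _
    have hanti : Antitone fun t : ℝ => ρ.real {a | t ≤ f a} := fun s t hst =>
      measureReal_mono fun a (ha : t ≤ f a) => hst.trans ha
    exact (Integrable.of_mem_Icc 0 1 hanti.measurable.aemeasurable
      (Filter.Eventually.of_forall fun t => ⟨measureReal_nonneg, measureReal_le_one⟩))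
  rw [key μ inferInstance, key ν inferInstance, ← integral_sub (hint μ inferInstance)
    (hint ν inferInstance)]
  calc ∫ t in Set.Ioc 0 b, (μ.real {a | t ≤ f a} - ν.real {a | t ≤ f a})
      ≤ ∫ _ in Set.Ioc 0 b, tvDist μ ν := by
        refine integral_mono ((hint μ inferInstance).sub (hint ν inferInstance))
          (integrable_const _) fun t => ?_
        exact (le_abs_self _).trans (le_tvDist μ ν (measurableSet_le measurable_const hf))
    _ = b * tvDist μ ν := by simp [hb]

/-- The expected sum of `f` over the first `k + 1` steps of the chain started at `s`. -/
def potential (T : Kernel S S) (f : S → ℝ) (k : ℕ) (s : S) : ℝ :=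
  ∑ j ∈ Finset.range (k + 1), ∫ y, f y ∂(kernelIter T j s)

lemma kernelIter_succ' (T : Kernel S S) (k : ℕ) :
    kernelIter T (k + 1) = kernelIter T k ∘ₖ T := by
  induction k with
  | zero => simp [kernelIter]
  | succ k ih =>
    change T ∘ₖ kernelIter T (k + 1) = (T ∘ₖ kernelIter T k) ∘ₖ T
    rw [ih, Kernel.comp_assoc]

lemma potential_zero (T : Kernel S S) {f : S → ℝ} (hf : Measurable f) (s : S) :
    potential T f 0 s = f s := by
  simp [potential, kernelIter, Kernel.id_apply, integral_dirac' _ _ hf.stronglyMeasurable]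

lemma measurable_integral_kernelIter (T : Kernel S S) [IsMarkovKernel T] {f : S → ℝ}
    (hf : Measurable f) (k : ℕ) : Measurable fun s => ∫ y, f y ∂(kernelIter T k s) :=
  hf.stronglyMeasurable.integral_kernel.measurable

lemma measurable_potential (T : Kernel S S) [IsMarkovKernel T] {f : S → ℝ}
    (hf : Measurable f) (k : ℕ) : Measurable (potential T f k) :=
  Finset.measurable_fun_sum _ fun j _ => measurable_integral_kernelIter T hf j

lemma integral_mem_Icc {μ : Measure S} [IsProbabilityMeasure μ] {f : S → ℝ} {a b : ℝ}
    (hf : Measurable f) (hfb : ∀ s, f s ∈ Set.Icc a b) : ∫ y, f y ∂μ ∈ Set.Icc a b := by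
  have hi : Integrable f μ := integrable_of_mem_Icc hf hfb
  constructor
  · simpa using integral_mono (integrable_const (μ := μ) a) hi fun s => (hfb s).1
  · simpa using integral_mono hi (integrable_const (μ := μ) b) fun s => (hfb s).2

lemma potential_mem_Icc (T : Kernel S S) [IsMarkovKernel T] {f : S → ℝ} {b : ℝ}
    (hf : Measurable f) (hfb : ∀ s, f s ∈ Set.Icc 0 b) (k : ℕ) (s : S) :
    potential T f k s ∈ Set.Icc 0 ((k + 1) * b) := by
  constructor
  · exact Finset.sum_nonneg fun j _ => (integral_mem_Icc hf hfb).1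
  · calc potential T f k s ≤ ∑ j ∈ Finset.range (k + 1), b :=
          Finset.sum_le_sum fun j _ => (integral_mem_Icc hf hfb).2
      _ = (k + 1) * b := by simp

lemma potential_succ (T : Kernel S S) [IsMarkovKernel T] {f : S → ℝ} {b : ℝ}
    (hf : Measurable f) (hfb : ∀ s, f s ∈ Set.Icc 0 b) (k : ℕ) (s : S) :
    potential T f (k + 1) s = f s + ∫ y, potential T f k y ∂(T s) := by
  have h0 : ∫ y, f y ∂(kernelIter T 0 s) = f s := by
    simp [kernelIter, Kernel.id_apply, integral_dirac' _ _ hf.stronglyMeasurable]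
  unfold potential
  rw [Finset.sum_range_succ', h0, add_comm, integral_finsetSum]
  · congr 1
    refine Finset.sum_congr rfl fun j _ => ?_
    rw [kernelIter_succ', Kernel.integral_comp (integrable_of_mem_Icc hf hfb)]
  · intro j _
    exact integrable_of_mem_Icc (measurable_integral_kernelIter T hf j)
      fun s => integral_mem_Icc hf hfb

lemma potential_sub_le (T : Kernel S S) [IsMarkovKernel T] {f : S → ℝ} {b K : ℝ} (hb : 0 ≤ b)
    (hf : Measurable f) (hfb : ∀ s, f s ∈ Set.Icc 0 b)
    (hK : ∀ n, opNorm (depMatrix T n) ^ 2 ≤ K) (k : ℕ) (s s' : S) :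
    potential T f k s - potential T f k s' ≤ b * K := by
  unfold potential
  rw [← Finset.sum_sub_distrib]
  calc _ ≤ ∑ j ∈ Finset.range (k + 1), b * mixCoeff T j := by
        refine Finset.sum_le_sum fun j _ => ?_
        exact (integral_sub_integral_le_mul_tvDist _ _ hb hf hfb).trans
          (mul_le_mul_of_nonneg_left (tvDist_le_mixCoeff T j s s') hb)
    _ ≤ b * K := by
        rw [← Finset.mul_sum]
        exact mul_le_mul_of_nonneg_left ((sum_mixCoeff_le T k).trans (hK _)) hb

/-! ### Hoeffding's lemma for functions of bounded oscillation -/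

lemma lintegral_exp_le_of_osc_le (μ : Measure S) [IsProbabilityMeasure μ] {h : S → ℝ} {c : ℝ}
    (hm : Measurable h) (h0 : ∀ s, 0 ≤ h s) (hc : ∀ s s', h s - h s' ≤ c) (l : ℝ) :
    ∫⁻ s, ENNReal.ofReal (exp (l * h s)) ∂μ
      ≤ ENNReal.ofReal (exp (l * ∫ s, h s ∂μ + (c / 2) ^ 2 * l ^ 2 / 2)) := by
  have hne : Nonempty S := μ.nonempty_of_neZero
  have hmem : ∀ s, h s ∈ Set.Icc (⨅ y, h y) ((⨅ y, h y) + c) := by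
    intro s
    refine ⟨ciInf_le ⟨0, by rintro _ ⟨y, rfl⟩; exact h0 y⟩ s, ?_⟩
    have : h s - c ≤ ⨅ y, h y := le_ciInf fun y => by linarith [hc s y]
    linarith
  have hsub := hasSubgaussianMGF_of_mem_Icc (μ := μ) hm.aemeasurable
    (Filter.Eventually.of_forall hmem)
  have hmgf := hsub.mgf_le l
  have hexp : ∀ s, exp (l * h s) = exp (l * ∫ y, h y ∂μ) * exp (l * (h s - ∫ y, h y ∂μ)) := by
    intro s
    rw [← exp_add]
    ring_nf
  have hi := hsub.integrable_exp_mul l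
  rw [← ofReal_integral_eq_lintegral_ofReal _ (Filter.Eventually.of_forall fun s => (exp_pos _).le)]
  · refine ENNReal.ofReal_le_ofReal ?_
    simp_rw [hexp]
    rw [integral_const_mul, exp_add]
    refine mul_le_mul_of_nonneg_left (hmgf.trans (le_of_eq ?_)) (exp_pos _).le
    simp [div_pow]
  · simp_rw [hexp]
    exact hi.const_mul _

/-! ### The Markov property for bounded weights and general integrands -/

lemma pastFiltration_le {Ω : Type*} [MeasurableSpace Ω] {P : Measure Ω} {T : Kernel S S}
    {x : ℕ → Ω → S} {n : ℕ} (hx : IsMarkovChain P T x n) {t : ℕ} (ht : t < n) :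
    pastFiltration x t ≤ ‹MeasurableSpace Ω› := by
  refine Measurable.comap_le (measurable_pi_lambda _ fun i => hx.1 i ?_)
  have := i.2
  lia

lemma measurable_pastFiltration {Ω : Type*} (x : ℕ → Ω → S) {i t : ℕ} (hi : i ≤ t) :
    Measurable[pastFiltration x t] (x i) := by
  have h : Measurable[pastFiltration x t] (fun ω => fun j : Fin (t + 1) => x j ω) :=
    comap_measurable _
  exact (measurable_pi_apply (⟨i, by lia⟩ : Fin (t + 1))).comp h

/-- The Doob martingale of `∑ i < m + 1, f (x i)` at time `t ≤ m`. -/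
def doobSum {Ω : Type*} (T : Kernel S S) (f : S → ℝ) (x : ℕ → Ω → S) (m t : ℕ) (ω : Ω) : ℝ :=
  ∑ i ∈ Finset.range t, f (x i ω) + potential T f (m - t) (x t ω)

lemma doobSum_self {Ω : Type*} (T : Kernel S S) (x : ℕ → Ω → S) {f : S → ℝ} (hf : Measurable f) (m : ℕ) (ω : Ω) :
    doobSum T f x m m ω = ∑ i ∈ Finset.range (m + 1), f (x i ω) := by
  rw [doobSum, Nat.sub_self, potential_zero T hf, Finset.sum_range_succ]

section Markov

variable {Ω : Type*} [MeasurableSpace Ω] {P : Measure Ω} [IsProbabilityMeasure P]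
  {T : Kernel S S} {x : ℕ → Ω → S} {n : ℕ}

lemma IsMarkovChain.integral_mul_indicator (hx : IsMarkovChain P T x n) {t : ℕ} (ht : t + 1 < n)
    {W : Ω → ℝ} (hW : Measurable[pastFiltration x t] W) {C : ℝ} (hWC : ∀ ω, |W ω| ≤ C)
    {A : Set S} (hA : MeasurableSet A) :
    ∫ ω, W ω * A.indicator (fun _ => (1 : ℝ)) (x (t + 1) ω) ∂P
      = ∫ ω, W ω * (T (x t ω)).real A ∂P := by
  have hm := pastFiltration_le hx (t := t) (by lia)
  have hind : Integrable (fun ω => A.indicator (fun _ => (1 : ℝ)) (x (t + 1) ω)) P := by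
    refine Integrable.of_mem_Icc 0 1
      ((measurable_const.indicator hA).comp (hx.1 _ ht)).aemeasurable
      (Filter.Eventually.of_forall fun ω => ?_)
    by_cases h : x (t + 1) ω ∈ A <;> simp [h]
  have hpull := condExp_stronglyMeasurable_mul_of_bound hm hW.stronglyMeasurable hind C
    (Filter.Eventually.of_forall hWC)
  rw [← integral_condExp hm]
  refine integral_congr_ae ?_
  filter_upwards [hpull, hx.2 t ht A hA] with ω h1 h2
  refine h1.trans ?_
  rw [Pi.mul_apply, h2]
  rfl

variable [IsMarkovKernel T]

lemma IsMarkovChain.map_withDensity (hx : IsMarkovChain P T x n) {t : ℕ} (ht : t + 1 < n)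
    {W : Ω → ℝ} (hW : Measurable[pastFiltration x t] W) {C : ℝ} (hW0 : ∀ ω, 0 ≤ W ω)
    (hWC : ∀ ω, W ω ≤ C) :
    (P.withDensity fun ω => ENNReal.ofReal (W ω)).map (x (t + 1))
      = ((P.withDensity fun ω => ENNReal.ofReal (W ω)).map (x t)).bind T := by
  have hm := pastFiltration_le hx (t := t) (by lia)
  have hWm : Measurable W := hW.mono hm le_rfl
  have hxt := hx.1 t (by lia)
  have hxt1 := hx.1 (t + 1) ht
  have habs : ∀ ω, |W ω| ≤ C := fun ω => by rw [abs_of_nonneg (hW0 ω)]; exact hWC ω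
  ext A hA
  have hTA : Measurable fun s => T s A := T.measurable_coe hA
  have hTAx : Measurable fun ω => T (x t ω) A := hTA.comp hxt
  rw [Measure.bind_apply hA T.aemeasurable, lintegral_map hTA hxt,
    lintegral_withDensity_eq_lintegral_mul _ hWm.ennreal_ofReal hTAx,
    Measure.map_apply hxt1 hA, ← lintegral_indicator_one (hxt1 hA),
    lintegral_withDensity_eq_lintegral_mul _ hWm.ennreal_ofReal
      (measurable_one.indicator (hxt1 hA))]
  have hind : Measurable fun ω => A.indicator (fun _ => (1 : ℝ)) (x (t + 1) ω) :=
    (measurable_const.indicator hA).comp hxt1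
  have hTr : Measurable fun ω => (T (x t ω)).real A := (hTA.comp hxt).ennreal_toReal
  have hC : ∀ ω, 0 ≤ C := fun ω => (hW0 ω).trans (hWC ω)
  have hL : Integrable (fun ω => W ω * A.indicator (fun _ => (1 : ℝ)) (x (t + 1) ω)) P := by
    refine Integrable.of_mem_Icc 0 C (hWm.mul hind).aemeasurable
      (Filter.Eventually.of_forall fun ω => ?_)
    by_cases h : x (t + 1) ω ∈ A <;> simp [h, hW0 ω, hWC ω, hC ω]
  have hR : Integrable (fun ω => W ω * (T (x t ω)).real A) P := by
    refine Integrable.of_mem_Icc 0 C (hWm.mul hTr).aemeasurable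
      (Filter.Eventually.of_forall fun ω => ⟨mul_nonneg (hW0 ω) measureReal_nonneg, ?_⟩)
    exact (mul_le_of_le_one_right (hW0 ω) measureReal_le_one).trans (hWC ω)
  have h := congrArg ENNReal.ofReal (hx.integral_mul_indicator ht hW habs hA)
  rw [ofReal_integral_eq_lintegral_ofReal hL (Filter.Eventually.of_forall fun ω =>
      mul_nonneg (hW0 ω) (Set.indicator_nonneg (fun _ _ => zero_le_one) _)),
    ofReal_integral_eq_lintegral_ofReal hR (Filter.Eventually.of_forall fun ω =>
      mul_nonneg (hW0 ω) measureReal_nonneg)] at h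
  convert h using 1
  · refine lintegral_congr fun ω => ?_
    by_cases h : x (t + 1) ω ∈ A <;> simp [h, Set.indicator]
  · refine lintegral_congr fun ω => ?_
    rw [ENNReal.ofReal_mul (hW0 ω), ofReal_measureReal]
    rfl

lemma IsMarkovChain.lintegral_mul (hx : IsMarkovChain P T x n) {t : ℕ} (ht : t + 1 < n)
    {W : Ω → ℝ} (hW : Measurable[pastFiltration x t] W) {C : ℝ} (hW0 : ∀ ω, 0 ≤ W ω)
    (hWC : ∀ ω, W ω ≤ C) {G : S → ENNReal} (hG : Measurable G) :
    ∫⁻ ω, ENNReal.ofReal (W ω) * G (x (t + 1) ω) ∂P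
      = ∫⁻ ω, ENNReal.ofReal (W ω) * ∫⁻ y, G y ∂(T (x t ω)) ∂P := by
  have hWm : Measurable W := hW.mono (pastFiltration_le hx (by lia)) le_rfl
  have hxt := hx.1 t (by lia)
  have hxt1 := hx.1 (t + 1) ht
  have hTG : Measurable fun s => ∫⁻ y, G y ∂(T s) := hG.lintegral_kernel
  have h := congrArg (fun μ : Measure S => ∫⁻ y, G y ∂μ) (hx.map_withDensity ht hW hW0 hWC)
  have hGx : Measurable fun ω => G (x (t + 1) ω) := hG.comp hxt1
  have hTGx : Measurable fun ω => ∫⁻ y, G y ∂(T (x t ω)) := hTG.comp hxt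
  rw [Measure.lintegral_bind T.aemeasurable hG.aemeasurable, lintegral_map hG hxt1,
    lintegral_map hTG hxt,
    lintegral_withDensity_eq_lintegral_mul _ hWm.ennreal_ofReal hGx,
    lintegral_withDensity_eq_lintegral_mul _ hWm.ennreal_ofReal hTGx] at h
  exact h

lemma IsMarkovChain.integral_comp_succ (hx : IsMarkovChain P T x n) {t : ℕ} (ht : t + 1 < n)
    {h : S → ℝ} (hh : Measurable h) {a : ℝ} (hh0 : ∀ s, h s ∈ Set.Icc 0 a) :
    ∫ ω, h (x (t + 1) ω) ∂P = ∫ ω, ∫ y, h y ∂(T (x t ω)) ∂P := by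
  have hxt := hx.1 t (by lia)
  have hTh : Measurable fun s => ∫ y, h y ∂(T s) := hh.stronglyMeasurable.integral_kernel.measurable
  have key := hx.lintegral_mul ht (W := fun _ => 1) measurable_const (C := 1)
    (fun _ => zero_le_one) (fun _ => le_rfl) hh.ennreal_ofReal
  rw [integral_eq_lintegral_of_nonneg_ae (Filter.Eventually.of_forall fun ω => (hh0 _).1)
      (hh.comp (hx.1 _ ht)).aestronglyMeasurable,
    integral_eq_lintegral_of_nonneg_ae
      (Filter.Eventually.of_forall fun ω => (integral_mem_Icc hh hh0).1)
      (hTh.comp hxt).aestronglyMeasurable]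
  congr 1
  simp only [ENNReal.ofReal_one, one_mul] at key
  rw [key]
  refine lintegral_congr fun ω => ?_
  rw [ofReal_integral_eq_lintegral_ofReal (integrable_of_mem_Icc hh hh0)
    (Filter.Eventually.of_forall fun s => (hh0 s).1)]

lemma integral_doobSum_eq {m : ℕ} (hx : IsMarkovChain P T x (m + 1)) {f : S → ℝ} {b : ℝ}
    (hf : Measurable f) (hfb : ∀ s, f s ∈ Set.Icc 0 b) {t : ℕ} (ht : t ≤ m) :
    ∫ ω, doobSum T f x m t ω ∂P = ∫ ω, potential T f m (x 0 ω) ∂P := by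
  induction t with
  | zero => simp [doobSum]
  | succ t ih =>
    rw [← ih (by lia)]
    obtain ⟨k, rfl⟩ : ∃ k, m = t + 1 + k := ⟨m - (t + 1), by lia⟩
    have hk1 : t + 1 + k - (t + 1) = k := by lia
    have hk2 : t + 1 + k - t = k + 1 := by lia
    have hfi : ∀ i ≤ t, Integrable (fun ω => f (x i ω)) P := fun i hi =>
      integrable_of_mem_Icc (hf.comp (hx.1 i (by lia))) fun ω => hfb _
    have hp : ∀ j, ∀ i ≤ t + 1, Integrable (fun ω => potential T f j (x i ω)) P := fun j i hi =>
      integrable_of_mem_Icc ((measurable_potential T hf j).comp (hx.1 i (by lia)))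
        fun ω => potential_mem_Icc T hf hfb j _
    have hs : Integrable (fun ω => ∑ i ∈ Finset.range t, f (x i ω)) P :=
      integrable_finsetSum _ fun i hi => hfi i (Finset.mem_range.mp hi).le
    have hTp : Integrable (fun ω => ∫ y, potential T f k y ∂(T (x t ω))) P :=
      integrable_of_mem_Icc ((measurable_potential T hf
        k).stronglyMeasurable.integral_kernel.measurable.comp (hx.1 t (by lia)))
        fun ω => integral_mem_Icc (measurable_potential T hf k)
          (potential_mem_Icc T hf hfb k)
    simp only [doobSum, hk1, hk2, Finset.sum_range_succ, potential_succ T hf hfb]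
    have hsf : Integrable (fun ω => ∑ i ∈ Finset.range t, f (x i ω) + f (x t ω)) P :=
      hs.add (hfi t le_rfl)
    simp only [← add_assoc]
    rw [integral_add hsf (hp _ _ le_rfl), integral_add hsf hTp, hx.integral_comp_succ (by lia)
        (measurable_potential T hf k) (potential_mem_Icc T hf hfb k)]

lemma lintegral_exp_doobSum_le {m : ℕ} (hx : IsMarkovChain P T x (m + 1)) {f : S → ℝ}
    {b K : ℝ} (hb : 0 ≤ b) (hf : Measurable f) (hfb : ∀ s, f s ∈ Set.Icc 0 b)
    (hK : ∀ n, opNorm (depMatrix T n) ^ 2 ≤ K) (l : ℝ) {t : ℕ} (ht : t ≤ m) :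
    ∫⁻ ω, ENNReal.ofReal (exp (l * doobSum T f x m t ω)) ∂P
      ≤ ENNReal.ofReal (exp (l * ∫ ω, potential T f m (x 0 ω) ∂P
          + (t + 1) * ((b * K / 2) ^ 2 * l ^ 2 / 2))) := by
  induction t with
  | zero =>
    have := lintegral_exp_le_of_osc_le P
      ((measurable_potential T hf m).comp (hx.1 0 (by lia)))
      (fun ω => (potential_mem_Icc T hf hfb m _).1)
      (fun ω ω' => potential_sub_le T hb hf hfb hK m (x 0 ω) (x 0 ω')) l
    simpa [doobSum] using this
  | succ t ih =>
    have ih := ih (by lia)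
    obtain ⟨k, rfl⟩ : ∃ k, m = t + 1 + k := ⟨m - (t + 1), by lia⟩
    have hk1 : t + 1 + k - (t + 1) = k := by lia
    have hk2 : t + 1 + k - t = k + 1 := by lia
    set v := (b * K / 2) ^ 2 * l ^ 2 / 2 with hv
    set F : Ω → ℝ := fun ω => ∑ i ∈ Finset.range (t + 1), f (x i ω) with hF
    have hFm : Measurable[pastFiltration x t] F :=
      Finset.measurable_fun_sum _ fun i hi =>
        hf.comp (measurable_pastFiltration x (by have := Finset.mem_range.mp hi; lia))
    have hFabs : ∀ ω, |F ω| ≤ (t + 1) * b := by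
      intro ω
      refine (Finset.abs_sum_le_sum_abs _ _).trans ?_
      calc _ ≤ ∑ i ∈ Finset.range (t + 1), b := Finset.sum_le_sum fun i _ => by
            rw [abs_of_nonneg (hfb _).1]; exact (hfb _).2
        _ = _ := by simp
    have hpm := measurable_potential T hf k
    have hG : Measurable fun s => ENNReal.ofReal (exp (l * potential T f k s)) :=
      (measurable_exp.comp (hpm.const_mul l)).ennreal_ofReal
    have hW : Measurable[pastFiltration x t] fun ω => exp (l * F ω) :=
      measurable_exp.comp (hFm.const_mul l)
    calc ∫⁻ ω, ENNReal.ofReal (exp (l * doobSum T f x (t + 1 + k) (t + 1) ω)) ∂P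
        = ∫⁻ ω, ENNReal.ofReal (exp (l * F ω))
            * ENNReal.ofReal (exp (l * potential T f k (x (t + 1) ω))) ∂P := by
          refine lintegral_congr fun ω => ?_
          rw [← ENNReal.ofReal_mul (exp_pos _).le, ← exp_add, doobSum, hk1, mul_add]
      _ = ∫⁻ ω, ENNReal.ofReal (exp (l * F ω))
            * ∫⁻ y, ENNReal.ofReal (exp (l * potential T f k y)) ∂(T (x t ω)) ∂P := by
          refine hx.lintegral_mul (by lia) hW (C := exp (|l| * ((t + 1) * b)))
            (fun ω => (exp_pos _).le) (fun ω => exp_le_exp.mpr ?_) hG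
          refine (le_abs_self _).trans ?_
          rw [abs_mul]
          exact mul_le_mul_of_nonneg_left (hFabs ω) (abs_nonneg _)
      _ ≤ ∫⁻ ω, ENNReal.ofReal (exp (l * F ω))
            * ENNReal.ofReal (exp (l * ∫ y, potential T f k y ∂(T (x t ω)) + v)) ∂P := by
          refine lintegral_mono fun ω => ?_
          gcongr
          exact lintegral_exp_le_of_osc_le _ hpm
            (fun s => (potential_mem_Icc T hf hfb k s).1)
            (potential_sub_le T hb hf hfb hK k) l
      _ = ∫⁻ ω, ENNReal.ofReal (exp (l * doobSum T f x (t + 1 + k) t ω))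
            * ENNReal.ofReal (exp v) ∂P := by
          refine lintegral_congr fun ω => ?_
          rw [← ENNReal.ofReal_mul (exp_pos _).le, ← ENNReal.ofReal_mul (exp_pos _).le,
            ← exp_add, ← exp_add, doobSum, hk2, potential_succ T hf hfb, hF]
          simp only [Finset.sum_range_succ]
          ring_nf
      _ = (∫⁻ ω, ENNReal.ofReal (exp (l * doobSum T f x (t + 1 + k) t ω)) ∂P)
            * ENNReal.ofReal (exp v) := lintegral_mul_const' _ _ ENNReal.ofReal_ne_top
      _ ≤ ENNReal.ofReal (exp (l * ∫ ω, potential T f (t + 1 + k) (x 0 ω) ∂P + (t + 1) * v))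
            * ENNReal.ofReal (exp v) := by gcongr
      _ = _ := by
          rw [← ENNReal.ofReal_mul (exp_pos _).le, ← exp_add]
          push_cast
          ring_nf

/-- Sums along the chain are sub-Gaussian with variance proxy `n (b K / 2)²`. -/
lemma IsMarkovChain.hasSubgaussianMGF_sum (hn : 0 < n) (hx : IsMarkovChain P T x n) {f : S → ℝ}
    {b K : ℝ} (hb : 0 ≤ b) (hf : Measurable f) (hfb : ∀ s, f s ∈ Set.Icc 0 b)
    (hK : ∀ n, opNorm (depMatrix T n) ^ 2 ≤ K) :
    HasSubgaussianMGF (fun ω => ∑ i ∈ Finset.range n, f (x i ω)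
      - ∫ ω', ∑ i ∈ Finset.range n, f (x i ω') ∂P) (n * ‖b * K / 2‖₊ ^ 2) P := by
  obtain ⟨m, rfl⟩ : ∃ m, n = m + 1 := ⟨n - 1, by lia⟩
  have hFm : Measurable fun ω => ∑ i ∈ Finset.range (m + 1), f (x i ω) :=
    Finset.measurable_fun_sum _ fun i hi => hf.comp (hx.1 i (Finset.mem_range.mp hi))
  have hFb : ∀ ω, ∑ i ∈ Finset.range (m + 1), f (x i ω) ∈ Set.Icc 0 ((m + 1) * b) := by
    intro ω
    refine ⟨Finset.sum_nonneg fun i _ => (hfb _).1, ?_⟩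
    calc _ ≤ ∑ i ∈ Finset.range (m + 1), b := Finset.sum_le_sum fun i _ => (hfb _).2
      _ = _ := by simp
  have hmean : ∫ ω, potential T f m (x 0 ω) ∂P
      = ∫ ω, ∑ i ∈ Finset.range (m + 1), f (x i ω) ∂P := by
    rw [← integral_doobSum_eq hx hf hfb le_rfl]
    simp_rw [doobSum_self T x hf]
  have hint := (hasSubgaussianMGF_of_mem_Icc (μ := P) hFm.aemeasurable
    (Filter.Eventually.of_forall hFb)).integrable_exp_mul
  refine ⟨hint, fun l => ?_⟩
  have key := lintegral_exp_doobSum_le hx hb hf hfb hK l (t := m) le_rfl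
  simp_rw [doobSum_self T x hf] at key
  rw [hmean] at key
  set E := ∫ ω, ∑ i ∈ Finset.range (m + 1), f (x i ω) ∂P
  have hexp : ∀ ω, exp (l * ∑ i ∈ Finset.range (m + 1), f (x i ω))
      = exp (l * E) * exp (l * (∑ i ∈ Finset.range (m + 1), f (x i ω) - E)) := by
    intro ω
    rw [← exp_add]
    ring_nf
  rw [← ofReal_integral_eq_lintegral_ofReal (by simp_rw [hexp]; exact (hint l).const_mul _)
    (Filter.Eventually.of_forall fun ω => (exp_pos _).le),
    ENNReal.ofReal_le_ofReal_iff (exp_pos _).le] at key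
  simp_rw [hexp] at key
  rw [integral_const_mul, exp_add] at key
  refine (le_of_mul_le_mul_left key (exp_pos _)).trans (le_of_eq ?_)
  push_cast
  rw [Real.norm_eq_abs, sq_abs]
  ring_nf

end Markov

lemma measureReal_abs_gt_le_of_hasSubgaussianMGF {Ω : Type*} [MeasurableSpace Ω] {P : Measure Ω}
    [IsProbabilityMeasure P] {X : Ω → ℝ} {c : NNReal} (hX : HasSubgaussianMGF X c P) {ε : ℝ}
    (hε : 0 ≤ ε) : P.real {ω | ε < |X ω|} ≤ 2 * exp (-ε ^ 2 / (2 * c)) := by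
  have hsub : {ω | ε < |X ω|} ⊆ {ω | ε ≤ X ω} ∪ {ω | ε ≤ (-X) ω} := by
    intro ω hω
    rcases lt_abs.mp (show ε < |X ω| from hω) with h | h
    · exact Or.inl h.le
    · exact Or.inr h.le
  calc P.real {ω | ε < |X ω|} ≤ P.real {ω | ε ≤ X ω} + P.real {ω | ε ≤ (-X) ω} :=
        (measureReal_mono hsub).trans (measureReal_union_le _ _)
    _ ≤ _ := by linarith [hX.measure_ge_le hε, hX.neg.measure_ge_le hε]

end Helpers

/-- Concentration of empirical averages along a uniformly quickly mixing Markov chain: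
there exist constants `c₁ > 0`, `c₂ ≥ 1` depending only on the transition kernel `T` such
that for any chain with kernel `T`, any measurable `f : S → [0, b]` and any `0 < ξ < 1`,
with probability at least `1 - ξ`,
`|E[f̂] - f̂| ≤ b √((c₁/n) log(c₂/ξ))`, where `f̂ = (1/n) ∑ᵢ f(xᵢ)`. -/
theorem empirical_average_concentration_mixing
    {S : Type*} [MeasurableSpace S]
    (T : ProbabilityTheory.Kernel S S) [IsMarkovKernel T]
    (hmix : UniformlyQuicklyForgets T) :
    ∃ c₁ c₂ : ℝ, 0 < c₁ ∧ 1 ≤ c₂ ∧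
      ∀ (Ω : Type) (_ : MeasurableSpace Ω) (P : Measure Ω), IsProbabilityMeasure P →
      ∀ (n : ℕ), 0 < n →
      ∀ (x : ℕ → Ω → S), IsMarkovChain P T x n →
      ∀ (b : ℝ) (f : S → ℝ), Measurable f → (∀ s, f s ∈ Set.Icc 0 b) →
      ∀ (ξ : ℝ), 0 < ξ → ξ < 1 →
        1 - ENNReal.ofReal ξ ≤
          P {ω | |(∫ ω', (1 / (n : ℝ)) * ∑ i ∈ Finset.range n, f (x i ω') ∂P) -
                  (1 / (n : ℝ)) * ∑ i ∈ Finset.range n, f (x i ω)| ≤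
                b * Real.sqrt (c₁ / n * Real.log (c₂ / ξ))} := by
  obtain ⟨τ, hτ⟩ := hmix
  set K := max τ 1 with hKdef
  have hK : ∀ n, opNorm (depMatrix T n) ^ 2 ≤ K := fun n => (hτ n).trans (le_max_left _ _)
  have hK0 : 0 < K := lt_of_lt_of_le one_pos (le_max_right _ _)
  refine ⟨K ^ 2 / 2, 2, by positivity, one_le_two, ?_⟩
  intro Ω _ P _ n hn x hx b f hf hfb ξ hξ0 hξ1
  have hn' : (0 : ℝ) < n := by exact_mod_cast hn
  have hb : 0 ≤ b := by
    obtain ⟨ω⟩ := P.nonempty_of_neZero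
    exact (hfb (x 0 ω)).1.trans (hfb (x 0 ω)).2
  set F : Ω → ℝ := fun ω => ∑ i ∈ Finset.range n, f (x i ω) with hF
  set E := ∫ ω, F ω ∂P with hE
  set L := Real.log (2 / ξ) with hL
  have hLpos : 0 < L := Real.log_pos (by rw [lt_div_iff₀ hξ0]; linarith)
  set s := √(K ^ 2 / 2 / n * L) with hs
  have hs2 : s ^ 2 = K ^ 2 / 2 / n * L := Real.sq_sqrt (by positivity)
  have hFm : Measurable F :=
    Finset.measurable_fun_sum _ fun i hi => hf.comp (hx.1 i (Finset.mem_range.mp hi))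
  have hset : {ω | |(∫ ω', (1 / (n : ℝ)) * ∑ i ∈ Finset.range n, f (x i ω') ∂P) -
      (1 / (n : ℝ)) * ∑ i ∈ Finset.range n, f (x i ω)| ≤ b * s}
      = {ω | n * (b * s) < |F ω - E|}ᶜ := by
    ext ω
    rw [integral_const_mul, Set.mem_compl_iff, Set.mem_ofPred_eq, Set.mem_ofPred_eq, not_lt,
      ← mul_sub, abs_mul, abs_sub_comm, abs_of_pos (by positivity : 0 < 1 / (n : ℝ)),
      one_div, inv_mul_le_iff₀ hn']
  have hmeas : MeasurableSet {ω | n * (b * s) < |F ω - E|} :=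
    measurableSet_lt measurable_const (measurable_norm.comp (hFm.sub_const E))
  rw [hset, prob_compl_eq_one_sub hmeas]
  refine tsub_le_tsub_left ?_ 1
  rw [← ofReal_measureReal]
  refine ENNReal.ofReal_le_ofReal ?_
  rcases hb.eq_or_lt with rfl | hbpos
  · have hf0 : ∀ y, f y = 0 := fun y => le_antisymm (hfb y).2 (hfb y).1
    simp [hE, hF, hf0, hξ0.le]
  · refine (measureReal_abs_gt_le_of_hasSubgaussianMGF
      (hx.hasSubgaussianMGF_sum hn hb hf hfb hK) (by positivity)).trans (le_of_eq ?_)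
    have hexponent : -(n * (b * s)) ^ 2 / (2 * ((n * ‖b * K / 2‖₊ ^ 2 : NNReal) : ℝ)) = -L := by
      push_cast
      rw [Real.norm_eq_abs, sq_abs, mul_pow, mul_pow, hs2]
      field_simp
    rw [hexponent, hL, Real.exp_neg, Real.exp_log (by positivity)]
    field_simp

end
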